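/- For n ≥ 1, the Laurent polynomial Q_n[z] := (ab)^{-1} z^{-1}(1−az)(1−bz)·P_{n-1}[z; qa, qb, c, d | q] satisfies D Q_n = (q^{-n} + abcd q^{n-1}) Q_n and T_1 Q_n = −Q_n, where D and T_1 are the DAHA operators of the basic representation. -/

import Mathlib

open scoped BigOperators

noncomputable section

/-- The field of rational functions over ℂ, in which Laurent polynomials live. -/
local notation "F" => RatFunc ℂ

/-- Scalar constants in `F`. -/
def Cc (x : ℂ) : F := RatFunc.C x

/-- The variable `z`. -/
def Xv : F := RatFunc.X

/-- Substitution `z ↦ t` in a rational function (well defined since the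
substitution points used here are transcendental over ℂ). -/
def subst (t : F) (f : F) : F := RatFunc.eval (RatFunc.C) t f

/-- `f` is a Laurent polynomial in `z`. -/
def IsLaurent (f : F) : Prop :=
  ∃ (p : Polynomial ℂ) (n : ℕ), f = algebraMap (Polynomial ℂ) F p / Xv ^ n

/-- The DAHA operator `T₁` of the basic representation. -/
def T1op (a b : ℂ) (f : F) : F :=
  ((Cc a + Cc b) * Xv - (1 + Cc a * Cc b)) / (1 - Xv ^ 2) * f
    + ((1 - Cc a * Xv) * (1 - Cc b * Xv)) / (1 - Xv ^ 2) * subst Xv⁻¹ f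

/-- The DAHA operator `T₀` of the basic representation. -/
def T0op (q c d : ℂ) (f : F) : F :=
  (Cc q)⁻¹ * Xv * ((Cc c * Cc d + Cc q) * Xv - (Cc c + Cc d) * Cc q) / (Cc q - Xv ^ 2) * f
    - ((Cc c - Xv) * (Cc d - Xv)) / (Cc q - Xv ^ 2) * subst (Cc q * Xv⁻¹) f

/-- The inverse of `T₁`: `T₁⁻¹ = -(ab)⁻¹T₁ - (1 + (ab)⁻¹)`. -/
def T1inv (a b : ℂ) (f : F) : F :=
  -(Cc a * Cc b)⁻¹ * T1op a b f - (1 + (Cc a * Cc b)⁻¹) * f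

/-- The inverse of `T₀`: `T₀⁻¹ = -q(cd)⁻¹T₀ - (1 + q(cd)⁻¹)`. -/
def T0inv (q c d : ℂ) (f : F) : F :=
  -(Cc q * (Cc c * Cc d)⁻¹) * T0op q c d f - (1 + Cc q * (Cc c * Cc d)⁻¹) * f

/-- `Y = T₁T₀`. -/
def Yop (q a b c d : ℂ) (f : F) : F := T1op a b (T0op q c d f)

/-- `Y⁻¹ = T₀⁻¹T₁⁻¹`. -/
def Yinv (q a b c d : ℂ) (f : F) : F := T0inv q c d (T1inv a b f)

/-- `D = Y + q⁻¹abcd·Y⁻¹`. -/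
def Dop (q a b c d : ℂ) (f : F) : F :=
  Yop q a b c d f + Cc (q⁻¹ * (a * b * c * d)) * Yinv q a b c d f

/-- The Askey–Wilson second order q-difference operator `D_sym`. -/
def DsymOp (q a b c d : ℂ) (f : F) : F :=
  ((1 - Cc a * Xv) * (1 - Cc b * Xv) * (1 - Cc c * Xv) * (1 - Cc d * Xv)) /
      ((1 - Xv ^ 2) * (1 - Cc q * Xv ^ 2)) * (subst (Cc q * Xv) f - f)
    + ((Cc a - Xv) * (Cc b - Xv) * (Cc c - Xv) * (Cc d - Xv)) /
      ((1 - Xv ^ 2) * (Cc q - Xv ^ 2)) * (subst ((Cc q)⁻¹ * Xv) f - f)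
    + (1 + (Cc q)⁻¹ * Cc a * Cc b * Cc c * Cc d) * f

/-- q-Pochhammer symbol `(x;q)_k`. -/
def qPoch (x q : ℂ) (k : ℕ) : ℂ := ∏ j ∈ Finset.range k, (1 - x * q ^ j)

/-- The monic Askey–Wilson Laurent polynomial `P_n[z;a,b,c,d|q]`. -/
def AWP (q a b c d : ℂ) (n : ℕ) : F :=
  Cc (a⁻¹ ^ n) * ∑ k ∈ Finset.range (n + 1),
    Cc (qPoch (q⁻¹ ^ n) q k * qPoch (a * b * q ^ k) q (n - k) * qPoch (a * c * q ^ k) q (n - k)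
        * qPoch (a * d * q ^ k) q (n - k) * q ^ k
        / (qPoch q q k * qPoch (a * b * c * d * q ^ (n + k) / q) q (n - k)))
      * (∏ j ∈ Finset.range k, (1 - Cc a * Xv * Cc (q ^ j)))
      * (∏ j ∈ Finset.range k, (1 - Cc a * Xv⁻¹ * Cc (q ^ j)))

/-- `Q_n[z] := (ab)⁻¹ z⁻¹ (1-az)(1-bz) P_{n-1}[z;qa,qb,c,d|q]`. -/
def Qpoly (q a b c d : ℂ) (n : ℕ) : F :=
  (Cc (a * b))⁻¹ * Xv⁻¹ * (1 - Cc a * Xv) * (1 - Cc b * Xv) *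
    AWP q (q * a) (q * b) c d (n - 1)

/-- Elementary symmetric polynomials in a,b,c,d. -/
def esym1 (a b c d : ℂ) : ℂ := a + b + c + d
def esym2 (a b c d : ℂ) : ℂ := a*b + a*c + b*c + a*d + b*d + c*d
def esym3 (a b c d : ℂ) : ℂ := a*b*c + a*b*d + a*c*d + b*c*d
def esym4 (a b c d : ℂ) : ℂ := a*b*c*d

/-! ### Substitution homomorphisms -/

theorem exists_hom (t : F) (ht : Transcendental ℂ t) :
    ∃ s : F →+* F, (∀ f, subst t f = s f) ∧ (∀ x, s (Cc x) = Cc x) ∧ s Xv = t := by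
  have key : ∀ p : Polynomial ℂ, p ≠ 0 → Polynomial.eval₂ RatFunc.C t p ≠ 0 := by
    intro p hp h
    apply ht
    refine ⟨p, hp, ?_⟩
    rw [Polynomial.aeval_def, RatFunc.algebraMap_eq_C]
    exact h
  have key2 : ∀ f : F, Polynomial.eval₂ RatFunc.C t f.denom ≠ 0 :=
    fun f => key _ (RatFunc.denom_ne_zero f)
  refine ⟨{ toFun := subst t
            map_one' := RatFunc.eval_one _ _
            map_zero' := RatFunc.eval_zero _ _
            map_add' := fun x y => RatFunc.eval_add _ _ (key2 x) (key2 y)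
            map_mul' := fun x y => RatFunc.eval_mul _ _ (key2 x) (key2 y) }, fun f => rfl, ?_, ?_⟩
  · intro x
    exact RatFunc.eval_C _ _
  · exact RatFunc.eval_X _ _

theorem transc_X : Transcendental ℂ Xv := RatFunc.transcendental_X

theorem transc_inv : Transcendental ℂ (Xv⁻¹) := by
  rw [Transcendental, IsAlgebraic.inv_iff]
  exact transc_X

theorem transc_qinv (q : ℂ) (hq : q ≠ 0) : Transcendental ℂ (Cc q * Xv⁻¹) := by
  intro h
  apply transc_inv
  have h2 : IsAlgebraic ℂ (Cc q⁻¹) := by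
    have := isAlgebraic_algebraMap (R := ℂ) (A := F) q⁻¹
    rwa [RatFunc.algebraMap_eq_C] at this
  have h3 := h2.mul h
  have h4 : Cc q⁻¹ * (Cc q * Xv⁻¹) = Xv⁻¹ := by
    rw [← mul_assoc, Cc, Cc, ← map_mul, inv_mul_cancel₀ hq, map_one, one_mul]
  rwa [h4] at h3

theorem Xv_ne : Xv ≠ 0 := RatFunc.X_ne_zero

theorem poly_ne (p : Polynomial ℂ) (hp : p ≠ 0) : Polynomial.aeval Xv p ≠ 0 := by
  intro h
  exact transc_X ⟨p, hp, h⟩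

theorem lin_ne (x : ℂ) : 1 - Cc x * Xv ≠ 0 := by
  have := poly_ne (1 - Polynomial.C x * Polynomial.X) (by
    intro h
    have := congrArg (Polynomial.eval 0) h
    simp at this)
  simpa [RatFunc.algebraMap_eq_C, Cc] using this

theorem lin_inv_ne (x : ℂ) : 1 - Cc x * Xv⁻¹ ≠ 0 := by
  have := poly_ne (Polynomial.X - Polynomial.C x) (Polynomial.X_sub_C_ne_zero x)
  simp only [map_sub, Polynomial.aeval_X, Polynomial.aeval_C, RatFunc.algebraMap_eq_C] at this
  intro h
  apply this
  have hX := Xv_ne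
  have h2 : Xv * (1 - Cc x * Xv⁻¹) = 0 := by rw [h, mul_zero]
  rw [mul_sub, mul_left_comm, mul_inv_cancel₀ hX, mul_one, mul_one] at h2
  exact h2

theorem quad_ne (x y : ℂ) (h : x ≠ 0) : Cc x - Cc y * Xv ^ 2 ≠ 0 := by
  have := poly_ne (Polynomial.C x - Polynomial.C y * Polynomial.X ^ 2) (by
    intro h'
    have := congrArg (Polynomial.eval 0) h'
    simp at this
    exact h this)
  simpa [RatFunc.algebraMap_eq_C, Cc] using this

theorem Cc_ne (x : ℂ) (h : x ≠ 0) : Cc x ≠ 0 := by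
  simpa [Cc] using h

theorem Cc_mul (x y : ℂ) : Cc (x * y) = Cc x * Cc y := map_mul _ _ _
theorem Cc_add (x y : ℂ) : Cc (x + y) = Cc x + Cc y := map_add _ _ _
theorem Cc_sub (x y : ℂ) : Cc (x - y) = Cc x - Cc y := map_sub _ _ _
theorem Cc_neg (x : ℂ) : Cc (-x) = -Cc x := map_neg _ _
theorem Cc_one : Cc 1 = 1 := map_one _
theorem Cc_inv (x : ℂ) : Cc x⁻¹ = (Cc x)⁻¹ := map_inv₀ _ _
theorem Cc_pow (x : ℂ) (n : ℕ) : Cc (x ^ n) = Cc x ^ n := map_pow _ _ _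

/-! ### Generic field identities -/

theorem core_T1 {K : Type*} [Field K] (z a b S : K) (hz : z ≠ 0) (ha : a ≠ 0) (hb : b ≠ 0)
    (h1 : 1 - z ^ 2 ≠ 0) :
    ((a + b) * z - (1 + a * b)) / (1 - z ^ 2) * ((a * b)⁻¹ * z⁻¹ * (1 - a * z) * (1 - b * z) * S)
    + ((1 - a * z) * (1 - b * z)) / (1 - z ^ 2)
      * ((a * b)⁻¹ * z * (1 - a * z⁻¹) * (1 - b * z⁻¹) * S)
    = -((a * b)⁻¹ * z⁻¹ * (1 - a * z) * (1 - b * z) * S) := by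
  field_simp
  ring

set_option maxRecDepth 100000 in
set_option maxHeartbeats 4000000 in
/-- The three-term computation of `D` in the basis. -/
theorem core_D {K : Type*} [Field K] (z a b c d q Q p P U V : K)
    (hz : z ≠ 0) (ha : a ≠ 0) (hb : b ≠ 0) (hq : q ≠ 0) (hQ : Q ≠ 0)
    (h1 : 1 - z ^ 2 ≠ 0) (h2 : q - z ^ 2 ≠ 0) (h3 : 1 - q * z ^ 2 ≠ 0)
    (hP : P = p * ((1 - q * a * Q * z) * (1 - q * a * Q * z⁻¹)))
    (hU : U = p * ((1 - q * a * Q * z⁻¹) * (1 - q * a * (q * Q) * z⁻¹) * (1 - a * z)))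
    (hV : V = p * ((1 - q * a * Q * z) * (1 - q * a * (q * Q) * z) * (1 - a * z⁻¹))) :
    ((1 - a * z) * (1 - b * z)) / (1 - z ^ 2) *
      ((q⁻¹ * z⁻¹ * ((c * d + q) * z⁻¹ - (c + d) * q) / (q - z⁻¹ ^ 2)
          * ((a * b)⁻¹ * z * (1 - a * z⁻¹) * (1 - b * z⁻¹) * P)
        - ((c - z⁻¹) * (d - z⁻¹)) / (q - z⁻¹ ^ 2)
          * ((a * b)⁻¹ * (q * z)⁻¹ * (1 - q * b * z) * V))
      - (q⁻¹ * z * ((c * d + q) * z - (c + d) * q) / (q - z ^ 2)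
          * ((a * b)⁻¹ * z⁻¹ * (1 - a * z) * (1 - b * z) * P)
        - ((c - z) * (d - z)) / (q - z ^ 2)
          * ((a * b)⁻¹ * (z * q⁻¹) * (1 - q * b * z⁻¹) * U)))
    + a * b * (1 + c * d * q⁻¹) * ((a * b)⁻¹ * z⁻¹ * (1 - a * z) * (1 - b * z) * P)
    = (a * b)⁻¹ * z⁻¹ * (1 - a * z) * (1 - b * z) *
      ((q⁻¹ * (q * Q)⁻¹ + a * b * c * d * (q * Q)) * P
        - q⁻¹ * (q * Q)⁻¹ * ((1 - q * Q) * (1 - q * a * (q * b) * Q) * (1 - q * a * c * Q)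
          * (1 - q * a * d * Q)) * p) := by
  subst hP hU hV
  have h4 : q - z⁻¹ ^ 2 ≠ 0 := by
    intro h
    apply h3
    field_simp at h
    linear_combination -h
  have e4 : q - z⁻¹ ^ 2 = -(1 - q * z ^ 2) / z ^ 2 := by
    field_simp
    ring
  have h3' : 1 - z ^ 2 * q ≠ 0 := by rwa [mul_comm]
  rw [e4]
  field_simp
  ring

set_option maxRecDepth 100000 in
set_option maxHeartbeats 4000000 in
theorem core_D0 {K : Type*} [Field K] (z a b c d q : K)
    (hz : z ≠ 0) (ha : a ≠ 0) (hb : b ≠ 0) (hq : q ≠ 0)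
    (h1 : 1 - z ^ 2 ≠ 0) (h2 : q - z ^ 2 ≠ 0) (h3 : 1 - q * z ^ 2 ≠ 0) :
    ((1 - a * z) * (1 - b * z)) / (1 - z ^ 2) *
      ((q⁻¹ * z⁻¹ * ((c * d + q) * z⁻¹ - (c + d) * q) / (q - z⁻¹ ^ 2)
          * ((a * b)⁻¹ * z * (1 - a * z⁻¹) * (1 - b * z⁻¹) * 1)
        - ((c - z⁻¹) * (d - z⁻¹)) / (q - z⁻¹ ^ 2)
          * ((a * b)⁻¹ * (q * z)⁻¹ * (1 - q * b * z) * (1 - q * a * z)))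
      - (q⁻¹ * z * ((c * d + q) * z - (c + d) * q) / (q - z ^ 2)
          * ((a * b)⁻¹ * z⁻¹ * (1 - a * z) * (1 - b * z) * 1)
        - ((c - z) * (d - z)) / (q - z ^ 2)
          * ((a * b)⁻¹ * (z * q⁻¹) * (1 - q * b * z⁻¹) * (1 - q * a * z⁻¹))))
    + a * b * (1 + c * d * q⁻¹) * ((a * b)⁻¹ * z⁻¹ * (1 - a * z) * (1 - b * z) * 1)
    = (a * b)⁻¹ * z⁻¹ * (1 - a * z) * (1 - b * z) *
      ((q⁻¹ + a * b * c * d) * 1) := by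
  have e4 : q - z⁻¹ ^ 2 = -(1 - q * z ^ 2) / z ^ 2 := by
    field_simp
    ring
  have h3' : 1 - z ^ 2 * q ≠ 0 := by rwa [mul_comm]
  rw [e4]
  field_simp
  ring

/-! ### q-products and the basis -/

/-- `∏_{j<m} (1 - x q^j)` in the function field. -/
def pr (q : ℂ) (x : F) (m : ℕ) : F := ∏ j ∈ Finset.range m, (1 - x * Cc (q ^ j))

theorem pr_succ (q : ℂ) (x : F) (m : ℕ) : pr q x (m + 1) = pr q x m * (1 - x * Cc q ^ m) := by
  rw [pr, Finset.prod_range_succ, Cc_pow]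
  rfl

theorem pr_succ' (q : ℂ) (x : F) (m : ℕ) :
    pr q x (m + 1) = (1 - x) * pr q (x * Cc q) m := by
  rw [pr, Finset.prod_range_succ', mul_comm, pow_zero, Cc_one, mul_one, pr]
  congr 1
  apply Finset.prod_congr rfl
  intro j _
  rw [pow_succ', Cc_mul, mul_assoc]

theorem map_pr (s : F →+* F) (hs : ∀ x, s (Cc x) = Cc x) (q : ℂ) (x : F) (m : ℕ) :
    s (pr q x m) = pr q (s x) m := by
  rw [pr, map_prod, pr]
  apply Finset.prod_congr rfl
  intro j _
  rw [map_sub, map_one, map_mul, hs]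

/-- The basis element `g · (qaz, qa/z; q)_k`. -/
def Wb (q a b : ℂ) (k : ℕ) : F :=
  (Cc a * Cc b)⁻¹ * Xv⁻¹ * (1 - Cc a * Xv) * (1 - Cc b * Xv) *
    (pr q (Cc (q * a) * Xv) k * pr q (Cc (q * a) * Xv⁻¹) k)

theorem T1_Wb (q a b : ℂ) (ha : a ≠ 0) (hb : b ≠ 0) (k : ℕ) :
    T1op a b (Wb q a b k) = - Wb q a b k := by
  obtain ⟨s, hs, hC, hX⟩ := exists_hom _ transc_inv
  have h1 : 1 - Xv ^ 2 ≠ 0 := by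
    simpa [Cc_one] using quad_ne 1 1 one_ne_zero
  have e : subst Xv⁻¹ (Wb q a b k) = (Cc a * Cc b)⁻¹ * Xv * (1 - Cc a * Xv⁻¹) * (1 - Cc b * Xv⁻¹) *
    (pr q (Cc (q * a) * Xv) k * pr q (Cc (q * a) * Xv⁻¹) k) := by
    rw [hs, Wb]
    simp only [map_mul, map_sub, map_one, map_inv₀, hC, hX, map_pr s hC, inv_inv]
    ring
  rw [T1op, e, Wb]
  exact core_T1 Xv (Cc a) (Cc b) _ Xv_ne (Cc_ne a ha) (Cc_ne b hb) h1

theorem D_anti (q a b c d : ℂ) (hq : q ≠ 0) (ha : a ≠ 0) (hb : b ≠ 0) (hc : c ≠ 0) (hd : d ≠ 0)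
    (f : F) (hf : T1op a b f = -f) :
    Dop q a b c d f = ((1 - Cc a * Xv) * (1 - Cc b * Xv)) / (1 - Xv ^ 2) *
      (subst Xv⁻¹ (T0op q c d f) - T0op q c d f)
      + Cc a * Cc b * (1 + Cc c * Cc d * (Cc q)⁻¹) * f := by
  have h1 : 1 - Xv ^ 2 ≠ 0 := by
    simpa [Cc_one] using quad_ne 1 1 one_ne_zero
  have hq' := Cc_ne q hq
  have ha' := Cc_ne a ha
  have hb' := Cc_ne b hb
  have hc' := Cc_ne c hc
  have hd' := Cc_ne d hd
  have e1 : T1inv a b f = -f := by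
    rw [T1inv, hf]
    ring
  have e2 : T0op q c d (-f) = - T0op q c d f := by
    obtain ⟨t, ht, -, -⟩ := exists_hom _ (transc_qinv q hq)
    simp only [T0op, ht, map_neg]
    ring
  rw [Dop, Yop, Yinv, e1, T0inv, e2, T1op]
  simp only [Cc_mul, Cc_inv]
  generalize T0op q c d f = h
  generalize subst Xv⁻¹ h = sh
  field_simp
  ring

/-- The explicit image of `f` under `D` when `T₁ f = -f`. -/
theorem D_Wb (q a b c d : ℂ) (hq : q ≠ 0) (ha : a ≠ 0) (hb : b ≠ 0) (hc : c ≠ 0) (hd : d ≠ 0)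
    (k : ℕ) (P U V : F)
    (hP : P = pr q (Cc (q * a) * Xv) k * pr q (Cc (q * a) * Xv⁻¹) k)
    (hU : U = (1 - Cc q * Cc a * Xv⁻¹) *
      (pr q (Cc (q * a) * Xv⁻¹ * Cc q) k * pr q (Cc a * Xv) k))
    (hV : V = (1 - Cc q * Cc a * Xv) *
      (pr q (Cc (q * a) * Xv * Cc q) k * pr q (Cc a * Xv⁻¹) k)) :
    Dop q a b c d (Wb q a b k) =
    ((1 - Cc a * Xv) * (1 - Cc b * Xv)) / (1 - Xv ^ 2) *
      (((Cc q)⁻¹ * Xv⁻¹ * ((Cc c * Cc d + Cc q) * Xv⁻¹ - (Cc c + Cc d) * Cc q) / (Cc q - Xv⁻¹ ^ 2)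
          * ((Cc a * Cc b)⁻¹ * Xv * (1 - Cc a * Xv⁻¹) * (1 - Cc b * Xv⁻¹) * P)
        - ((Cc c - Xv⁻¹) * (Cc d - Xv⁻¹)) / (Cc q - Xv⁻¹ ^ 2)
          * ((Cc a * Cc b)⁻¹ * (Cc q * Xv)⁻¹ * (1 - Cc q * Cc b * Xv) * V))
      - ((Cc q)⁻¹ * Xv * ((Cc c * Cc d + Cc q) * Xv - (Cc c + Cc d) * Cc q) / (Cc q - Xv ^ 2)
          * ((Cc a * Cc b)⁻¹ * Xv⁻¹ * (1 - Cc a * Xv) * (1 - Cc b * Xv) * P)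
        - ((Cc c - Xv) * (Cc d - Xv)) / (Cc q - Xv ^ 2)
          * ((Cc a * Cc b)⁻¹ * (Xv * (Cc q)⁻¹) * (1 - Cc q * Cc b * Xv⁻¹) * U)))
    + Cc a * Cc b * (1 + Cc c * Cc d * (Cc q)⁻¹)
      * ((Cc a * Cc b)⁻¹ * Xv⁻¹ * (1 - Cc a * Xv) * (1 - Cc b * Xv) * P) := by
  obtain ⟨s, hs, hsC, hsX⟩ := exists_hom _ transc_inv
  obtain ⟨t, ht, htC, htX⟩ := exists_hom _ (transc_qinv q hq)
  have hq' := Cc_ne q hq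
  have hX := Xv_ne
  have a1 : Cc (q * a) * (Cc q * Xv⁻¹) = Cc (q * a) * Xv⁻¹ * Cc q := by ring
  have a2 : Cc (q * a) * (Cc q * Xv⁻¹)⁻¹ = Cc a * Xv := by
    rw [Cc_mul]
    field_simp
  have etW : t (Wb q a b k) =
      (Cc a * Cc b)⁻¹ * (Xv * (Cc q)⁻¹) * (1 - Cc q * Cc b * Xv⁻¹) * U := by
    rw [hU, Wb]
    simp only [map_mul, map_sub, map_one, map_inv₀, htC, htX, map_pr t htC, a1, a2]
    rw [mul_inv (Cc q), inv_inv]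
    ring
  have esU : s U = V := by
    rw [hU, hV]
    simp only [map_mul, map_sub, map_one, map_inv₀, hsC, hsX, map_pr s hsC, inv_inv]
  have esW : s (Wb q a b k) =
      (Cc a * Cc b)⁻¹ * Xv * (1 - Cc a * Xv⁻¹) * (1 - Cc b * Xv⁻¹) * P := by
    rw [hP, Wb]
    simp only [map_mul, map_sub, map_one, map_inv₀, hsC, hsX, map_pr s hsC, inv_inv]
    ring
  have estW : s (t (Wb q a b k)) =
      (Cc a * Cc b)⁻¹ * (Cc q * Xv)⁻¹ * (1 - Cc q * Cc b * Xv) * V := by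
    rw [etW]
    simp only [map_mul, map_sub, map_one, map_inv₀, hsC, hsX, esU, inv_inv]
    rw [mul_inv (Cc q)]
    ring
  rw [D_anti q a b c d hq ha hb hc hd _ (T1_Wb q a b ha hb k), hs]
  have eT : T0op q c d (Wb q a b k) = (Cc q)⁻¹ * Xv * ((Cc c * Cc d + Cc q) * Xv
        - (Cc c + Cc d) * Cc q) / (Cc q - Xv ^ 2) * Wb q a b k
      - ((Cc c - Xv) * (Cc d - Xv)) / (Cc q - Xv ^ 2) * t (Wb q a b k) := by
    rw [T0op, ht]
  rw [eT]
  simp only [map_sub, map_add, map_mul, map_div₀, map_pow, map_inv₀, hsC, hsX, esW, estW]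
  rw [etW, Wb, ← hP]

theorem D_W0 (q a b c d : ℂ) (hq : q ≠ 0) (ha : a ≠ 0) (hb : b ≠ 0) (hc : c ≠ 0) (hd : d ≠ 0) :
    Dop q a b c d (Wb q a b 0) = Cc (q⁻¹ * (q ^ 0)⁻¹ + a * b * c * d * q ^ 0) * Wb q a b 0 := by
  have h1 : 1 - Xv ^ 2 ≠ 0 := by
    simpa [Cc_one] using quad_ne 1 1 one_ne_zero
  have h2 : Cc q - Xv ^ 2 ≠ 0 := by
    simpa [Cc_one] using quad_ne q 1 hq
  have h3 : 1 - Cc q * Xv ^ 2 ≠ 0 := by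
    simpa [Cc_one] using quad_ne 1 q one_ne_zero
  rw [D_Wb q a b c d hq ha hb hc hd 0 1 (1 - Cc q * Cc a * Xv⁻¹) (1 - Cc q * Cc a * Xv)
    (by simp [pr]) (by simp [pr]) (by simp [pr])]
  rw [core_D0 Xv (Cc a) (Cc b) (Cc c) (Cc d) (Cc q) Xv_ne (Cc_ne a ha) (Cc_ne b hb) (Cc_ne q hq)
    h1 h2 h3]
  simp only [Wb, pr, Finset.range_zero, Finset.prod_empty, pow_zero, Cc_add, Cc_mul, Cc_inv, Cc_one]
  ring

theorem D_Wsucc (q a b c d : ℂ) (hq : q ≠ 0) (ha : a ≠ 0) (hb : b ≠ 0) (hc : c ≠ 0) (hd : d ≠ 0)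
    (k : ℕ) :
    Dop q a b c d (Wb q a b (k + 1)) =
      Cc (q⁻¹ * (q ^ (k + 1))⁻¹ + a * b * c * d * q ^ (k + 1)) * Wb q a b (k + 1)
      - Cc (q⁻¹ * (q * q ^ k)⁻¹ * ((1 - q * q ^ k) * (1 - q * a * (q * b) * q ^ k)
        * (1 - q * a * c * q ^ k) * (1 - q * a * d * q ^ k))) * Wb q a b k := by
  have h1 : 1 - Xv ^ 2 ≠ 0 := by
    simpa [Cc_one] using quad_ne 1 1 one_ne_zero
  have h2 : Cc q - Xv ^ 2 ≠ 0 := by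
    simpa [Cc_one] using quad_ne q 1 hq
  have h3 : 1 - Cc q * Xv ^ 2 ≠ 0 := by
    simpa [Cc_one] using quad_ne 1 q one_ne_zero
  have hQ : Cc q ^ k ≠ 0 := pow_ne_zero _ (Cc_ne q hq)
  have e1 : ∀ x : F, (1 - Cc q * Cc a * x) * pr q (Cc (q * a) * x * Cc q) (k + 1) =
      pr q (Cc (q * a) * x) k * (1 - Cc q * Cc a * Cc q ^ k * x)
        * (1 - Cc q * Cc a * (Cc q * Cc q ^ k) * x) := by
    intro x
    have := pr_succ' q (Cc (q * a) * x) (k + 1)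
    rw [pr_succ, pr_succ, Cc_mul] at this
    rw [Cc_mul, ← this]
    ring
  have e2 : ∀ x : F, pr q (Cc a * x) (k + 1) = (1 - Cc a * x) * pr q (Cc (q * a) * x) k := by
    intro x
    rw [pr_succ', Cc_mul]
    congr 2
    ring
  rw [D_Wb q a b c d hq ha hb hc hd (k + 1) _ _ _ rfl rfl rfl]
  rw [core_D Xv (Cc a) (Cc b) (Cc c) (Cc d) (Cc q) (Cc q ^ k)
    (pr q (Cc (q * a) * Xv) k * pr q (Cc (q * a) * Xv⁻¹) k) _ _ _
    Xv_ne (Cc_ne a ha) (Cc_ne b hb) (Cc_ne q hq) hQ h1 h2 h3 ?_ ?_ ?_]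
  · simp only [Wb, Cc_add, Cc_mul, Cc_inv, Cc_one, Cc_sub, Cc_pow, pow_succ']
    ring
  · rw [pr_succ, pr_succ, Cc_mul]
    ring
  · rw [← mul_assoc, e1, e2]
    ring
  · rw [← mul_assoc, e1, e2]
    ring

/-! ### Linearity -/

theorem T1_add (a b : ℂ) (f g : F) : T1op a b (f + g) = T1op a b f + T1op a b g := by
  obtain ⟨s, hs, hC, hX⟩ := exists_hom _ transc_inv
  simp only [T1op, hs, map_add]
  ring

theorem T1_smul (a b x : ℂ) (f : F) : T1op a b (Cc x * f) = Cc x * T1op a b f := by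
  obtain ⟨s, hs, hC, hX⟩ := exists_hom _ transc_inv
  simp only [T1op, hs, map_mul, hC]
  ring

theorem T0_add (q c d : ℂ) (hq : q ≠ 0) (f g : F) :
    T0op q c d (f + g) = T0op q c d f + T0op q c d g := by
  obtain ⟨s, hs, hC, hX⟩ := exists_hom _ (transc_qinv q hq)
  simp only [T0op, hs, map_add]
  ring

theorem T0_smul (q c d : ℂ) (hq : q ≠ 0) (x : ℂ) (f : F) :
    T0op q c d (Cc x * f) = Cc x * T0op q c d f := by
  obtain ⟨s, hs, hC, hX⟩ := exists_hom _ (transc_qinv q hq)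
  simp only [T0op, hs, map_mul, hC]
  ring

theorem T1inv_add (a b : ℂ) (f g : F) : T1inv a b (f + g) = T1inv a b f + T1inv a b g := by
  simp only [T1inv, T1_add]
  ring

theorem T1inv_smul (a b x : ℂ) (f : F) : T1inv a b (Cc x * f) = Cc x * T1inv a b f := by
  simp only [T1inv, T1_smul]
  ring

theorem T0inv_add (q c d : ℂ) (hq : q ≠ 0) (f g : F) :
    T0inv q c d (f + g) = T0inv q c d f + T0inv q c d g := by
  simp only [T0inv, T0_add q c d hq]
  ring

theorem T0inv_smul (q c d : ℂ) (hq : q ≠ 0) (x : ℂ) (f : F) :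
    T0inv q c d (Cc x * f) = Cc x * T0inv q c d f := by
  simp only [T0inv, T0_smul q c d hq]
  ring

theorem D_add (q a b c d : ℂ) (hq : q ≠ 0) (f g : F) :
    Dop q a b c d (f + g) = Dop q a b c d f + Dop q a b c d g := by
  simp only [Dop, Yop, Yinv, T0_add q c d hq, T1_add, T1inv_add, T0inv_add q c d hq]
  ring

theorem D_smul (q a b c d : ℂ) (hq : q ≠ 0) (x : ℂ) (f : F) :
    Dop q a b c d (Cc x * f) = Cc x * Dop q a b c d f := by
  simp only [Dop, Yop, Yinv, T0_smul q c d hq, T1_smul, T1inv_smul, T0inv_smul q c d hq]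
  ring

theorem Cc_zero : Cc 0 = 0 := map_zero _

theorem lin_sum (L : F → F) (hadd : ∀ f g, L (f + g) = L f + L g)
    (hsmul : ∀ x f, L (Cc x * f) = Cc x * L f) (w : ℕ → ℂ) (W : ℕ → F) (N : ℕ) :
    L (∑ k ∈ Finset.range N, Cc (w k) * W k) = ∑ k ∈ Finset.range N, Cc (w k) * L (W k) := by
  induction N with
  | zero =>
    have := hsmul 0 0
    simpa [Cc_zero] using this
  | succ N ih => rw [Finset.sum_range_succ, Finset.sum_range_succ, hadd, ih, hsmul]

/-! ### Coefficients -/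

theorem qPoch_succ (x q : ℂ) (m : ℕ) : qPoch x q (m + 1) = qPoch x q m * (1 - x * q ^ m) := by
  rw [qPoch, Finset.prod_range_succ]
  rfl

theorem qPoch_succ' (x q : ℂ) (m : ℕ) : qPoch x q (m + 1) = (1 - x) * qPoch (x * q) q m := by
  rw [qPoch, Finset.prod_range_succ', mul_comm, pow_zero, mul_one, qPoch]
  congr 1
  apply Finset.prod_congr rfl
  intro j _
  rw [pow_succ', mul_assoc]

/-- The coefficients of the Askey–Wilson polynomial. -/
def cf (q a b c d : ℂ) (n k : ℕ) : ℂ :=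
  qPoch (q⁻¹ ^ n) q k * qPoch (a * b * q ^ k) q (n - k) * qPoch (a * c * q ^ k) q (n - k)
        * qPoch (a * d * q ^ k) q (n - k) * q ^ k
        / (qPoch q q k * qPoch (a * b * c * d * q ^ (n + k) / q) q (n - k))

theorem cf_rec (q a b c d : ℂ) (hq : q ≠ 0) (hroot : ∀ m : ℕ, 1 ≤ m → q ^ m ≠ 1)
    (habcd : ∀ m : ℕ, a * b * c * d ≠ q⁻¹ ^ m) (N k : ℕ) (hk : k < N) :
    cf q (q * a) (q * b) c d N (k + 1) *
      (q⁻¹ * (q * q ^ k)⁻¹ * ((1 - q * q ^ k) * (1 - q * a * (q * b) * q ^ k)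
        * (1 - q * a * c * q ^ k) * (1 - q * a * d * q ^ k)))
    = ((q⁻¹ * (q ^ k)⁻¹ + a * b * c * d * q ^ k) - (q⁻¹ * (q ^ N)⁻¹ + a * b * c * d * q ^ N))
      * cf q (q * a) (q * b) c d N k := by
  obtain ⟨m, rfl⟩ : ∃ m, N = k + 1 + m := ⟨N - (k + 1), by omega⟩
  have s1 : k + 1 + m - (k + 1) = m := by omega
  have s2 : k + 1 + m - k = m + 1 := by omega
  have hQ : q ^ k ≠ 0 := pow_ne_zero _ hq
  have hu : 1 - q * q ^ k ≠ 0 := by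
    rw [← pow_succ', sub_ne_zero]
    exact (hroot (k + 1) (by omega)).symm
  have hpu : ∀ k : ℕ, qPoch q q k ≠ 0 := by
    intro k
    rw [qPoch, Finset.prod_ne_zero_iff]
    intro j _
    rw [← pow_succ', sub_ne_zero]
    exact (hroot (j + 1) (by omega)).symm
  have hw : ∀ j : ℕ, 1 - a * b * c * d * q ^ j ≠ 0 := by
    intro j h
    apply habcd j
    rw [inv_pow]
    exact eq_inv_of_mul_eq_one_left (sub_eq_zero.mp h).symm
  have e0 : q * a * (q * b) * c * d * q ^ (k + 1 + m + k) / q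
      = a * b * c * d * q ^ (k + 1 + m + k + 1) := by
    rw [pow_succ]
    field_simp
  have e1 : q * a * (q * b) * c * d * q ^ (k + 1 + m + (k + 1)) / q
      = a * b * c * d * q ^ (k + 1 + m + k + 1) * q := by
    rw [show k + 1 + m + (k + 1) = k + 1 + m + k + 1 from by omega, pow_succ]
    field_simp
  have he : qPoch (a * b * c * d * q ^ (k + 1 + m + k + 1) * q) q m ≠ 0 := by
    rw [qPoch, Finset.prod_ne_zero_iff]
    intro j _
    have := hw (k + 1 + m + k + 1 + 1 + j)
    rwa [pow_add, pow_succ, ← mul_assoc, ← mul_assoc] at this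
  have hw1 := hw (k + 1 + m + k + 1)
  have f1 : ∀ y : ℂ, y * q ^ (k + 1) = y * q ^ k * q := by
    intro y
    ring
  have hpk := hpu k
  rw [cf, cf, s1, s2, e0, e1, f1 (q * a * (q * b)), f1 (q * a * c), f1 (q * a * d), qPoch_succ, qPoch_succ (q), qPoch_succ' (_ * q ^ k),
    qPoch_succ' (_ * q ^ k), qPoch_succ' (_ * q ^ k), qPoch_succ' (_ * q ^ _)]
  generalize qPoch (a * b * c * d * q ^ (k + 1 + m + k + 1) * q) q m = e at *
  generalize qPoch q q k = u at *
  generalize qPoch (q * a * (q * b) * q ^ k * q) q m = F1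
  generalize qPoch (q * a * c * q ^ k * q) q m = F2
  generalize qPoch (q * a * d * q ^ k * q) q m = F3
  generalize qPoch (q⁻¹ ^ (k + 1 + m)) q k = F0
  have e3 : q ^ (k + 1 + m + k + 1) = q ^ (k + 1 + m) * q ^ k * q := by ring
  have hN : q ^ (k + 1 + m) ≠ 0 := pow_ne_zero _ hq
  rw [inv_pow, pow_succ q k]
  rw [e3] at hw1 ⊢
  generalize q ^ (k + 1 + m) = QN at *
  generalize q ^ k = Q at *
  have e4 : (q⁻¹ * Q⁻¹ + a * b * c * d * Q) - (q⁻¹ * QN⁻¹ + a * b * c * d * QN)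
      = q⁻¹ * Q⁻¹ * (1 - QN⁻¹ * Q) * (1 - a * b * c * d * (QN * Q * q)) := by
    field_simp
    ring
  rw [e4]
  generalize 1 - a * b * c * d * (QN * Q * q) = w at *
  generalize 1 - QN⁻¹ * Q = v at *
  generalize hv : 1 - q * Q = v2 at *
  field_simp

theorem sum_lemma (N : ℕ) (w l m : ℕ → F) (W DW : ℕ → F) (h0 : DW 0 = l 0 * W 0)
    (hs : ∀ k, DW (k + 1) = l (k + 1) * W (k + 1) - m k * W k)
    (hc : ∀ k, k < N → w (k + 1) * m k = (l k - l N) * w k) :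
    ∑ k ∈ Finset.range (N + 1), w k * DW k = l N * ∑ k ∈ Finset.range (N + 1), w k * W k := by
  have key : ∀ M, M ≤ N → ∑ k ∈ Finset.range (M + 1), w k * DW k
      = l N * ∑ k ∈ Finset.range (M + 1), w k * W k + (l M - l N) * w M * W M := by
    intro M
    induction M with
    | zero =>
      intro _
      simp [h0]
      ring
    | succ M ih =>
      intro hM
      rw [Finset.sum_range_succ, ih (by omega), hs, Finset.sum_range_succ _ (M + 1)]
      linear_combination (-W M) * hc M (by omega)
  rw [key N le_rfl]
  ring

theorem Qpoly_eq (q a b c d : ℂ) (N : ℕ) :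
    Qpoly q a b c d (N + 1) = Cc ((q * a)⁻¹ ^ N) * ∑ k ∈ Finset.range (N + 1),
      Cc (cf q (q * a) (q * b) c d N k) * Wb q a b k := by
  rw [Qpoly, AWP, Nat.add_sub_cancel, mul_left_comm, Finset.mul_sum]
  congr 1
  apply Finset.sum_congr rfl
  intro k _
  rw [Wb, Cc_mul a b]
  simp only [pr, cf]
  ring

theorem stmt17 (q a b c d : ℂ) (hq : q ≠ 0) (hroot : ∀ m : ℕ, 1 ≤ m → q ^ m ≠ 1)
    (ha : a ≠ 0) (hb : b ≠ 0) (hc : c ≠ 0) (hd : d ≠ 0)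
    (habcd : ∀ m : ℕ, a * b * c * d ≠ q⁻¹ ^ m) :
    ∀ n : ℕ, 1 ≤ n →
      Dop q a b c d (Qpoly q a b c d n)
          = Cc (q ^ (-(n : ℤ)) + a * b * c * d * q ^ ((n : ℤ) - 1)) * Qpoly q a b c d n
        ∧ T1op a b (Qpoly q a b c d n) = -Qpoly q a b c d n := by
  intro n hn
  obtain ⟨N, rfl⟩ : ∃ N, n = N + 1 := ⟨n - 1, by omega⟩
  rw [Qpoly_eq]
  constructor
  · have ev : q ^ (-((N + 1 : ℕ) : ℤ)) + a * b * c * d * q ^ (((N + 1 : ℕ) : ℤ) - 1)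
        = q⁻¹ * (q ^ N)⁻¹ + a * b * c * d * q ^ N := by
      have h1 : ((N + 1 : ℕ) : ℤ) - 1 = (N : ℤ) := by
        push_cast
        ring
      rw [h1, zpow_neg, zpow_natCast, zpow_natCast, pow_succ', mul_inv]
    rw [ev, D_smul q a b c d hq,
      lin_sum (Dop q a b c d) (D_add q a b c d hq) (D_smul q a b c d hq)]
    rw [mul_left_comm]
    congr 1
    refine sum_lemma N (fun k => Cc (cf q (q * a) (q * b) c d N k))
      (fun k => Cc (q⁻¹ * (q ^ k)⁻¹ + a * b * c * d * q ^ k))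
      (fun k => Cc (q⁻¹ * (q * q ^ k)⁻¹ * ((1 - q * q ^ k) * (1 - q * a * (q * b) * q ^ k)
        * (1 - q * a * c * q ^ k) * (1 - q * a * d * q ^ k))))
      (fun k => Wb q a b k) (fun k => Dop q a b c d (Wb q a b k))
      (D_W0 q a b c d hq ha hb hc hd) (D_Wsucc q a b c d hq ha hb hc hd) ?_
    intro k hk
    rw [← Cc_mul, ← Cc_sub, ← Cc_mul]
    exact congrArg Cc (cf_rec q a b c d hq hroot habcd N k hk)
  · rw [T1_smul, lin_sum (T1op a b) (T1_add a b) (T1_smul a b)]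
    simp only [T1_Wb q a b ha hb, mul_neg, Finset.sum_neg_distrib]

end
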